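/- Let A be an embedded arc in the 2-sphere S², and let p, q be two distinct points of S² not lying on A. Then there exists a continuous injective map γ : [0,1] → S² with γ(0) = p, γ(1) = q, whose image is disjoint from A. (This is the existence of embedded arcs in the complement of an embedded arc, used in the paper's Step 2 to construct the arcs α′ and β′ whose interiors avoid prescribed embedded arcs.) -/

import Mathlib

open Set Topology

/-- A nowhere vanishing continuous complex function on a real topological vector space has a
continuous logarithm. -/
lemma Complex.exists_continuous_exp_eq {E : Type*} [AddCommGroup E] [Module ℝ E]
    [TopologicalSpace E] [ContinuousAdd E] [ContinuousSMul ℝ E] [LocallyPathConnectedSpace E]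
    {g : E → ℂ} (hg : Continuous g) (h₀ : ∀ x, g x ≠ 0) :
    ∃ l : E → ℂ, Continuous l ∧ ∀ x, Complex.exp (l x) = g x := by
  have : ContractibleSpace E := RealTopologicalVectorSpace.contractibleSpace
  have hU : IsSimplyConnected (univ : Set E) := by
    have : ContractibleSpace (univ : Set E) :=
      (Homeomorph.Set.univ E).contractibleSpace_iff.mpr inferInstance
    exact SimplyConnectedSpace.ofContractible _
  obtain ⟨l, hl, he⟩ := Complex.exists_continuousOn_eqOn_exp_comp hU isOpen_univ hg.continuousOn
    (by rintro ⟨x, -, hx⟩; exact h₀ x hx)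
  exact ⟨l, continuousOn_univ.mp hl, fun x ↦ he (mem_univ x)⟩

/-- The function `z - a` has no continuous logarithm on a circle centred at `a`. -/
lemma Complex.not_forall_exp_eq_sub_on_sphere {a : ℂ} {R : ℝ} (hR : 0 < R) {l : ℂ → ℂ}
    (hl : Continuous l) : ¬ ∀ z ∈ Metric.sphere a R, Complex.exp (l z) = z - a := by
  intro h
  have hmem : ∀ θ : ℝ, a + R * Complex.exp (θ * Complex.I) ∈ Metric.sphere a R := fun θ ↦ by
    simp [Complex.norm_exp_ofReal_mul_I, abs_of_pos hR]
  have hlift : ∀ θ : ℝ, Complex.exp (l (a + R * Complex.exp (θ * Complex.I))) =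
      R * Complex.exp (θ * Complex.I) := fun θ ↦ by
    rw [h _ (hmem θ)]; ring
  have h0 := hlift 0
  simp only [Complex.ofReal_zero, zero_mul, Complex.exp_zero, mul_one] at h0
  have key := Complex.isCoveringMap_exp.eq_of_comp_eq
    (g₁ := fun θ : ℝ ↦ l (a + R * Complex.exp (θ * Complex.I)))
    (g₂ := fun θ : ℝ ↦ l (a + R) + θ * Complex.I)
    (by fun_prop) (by fun_prop)
    (by
      funext θ
      apply Subtype.ext
      simp only [Function.comp_apply]
      rw [hlift, Complex.exp_add, h0])
    0 (by simp)
  have h2 := congrFun key (2 * Real.pi)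
  simp [Complex.exp_two_pi_mul_I] at h2

/-- An arc in the plane does not contain the frontier of a nonempty bounded open set having a
point off the arc. -/
lemma Complex.not_frontier_subset_range_arc {f : Icc (0 : ℝ) 1 → ℂ} (hf : Continuous f)
    (hinj : Function.Injective f) {V : Set ℂ} (hV : Bornology.IsBounded V) {a : ℂ}
    (haV : a ∈ V) (ha : a ∉ range f) : ¬ frontier V ⊆ range f := by
  classical
  intro hfr
  obtain ⟨G, hG, hGe⟩ := Complex.exists_continuous_exp_eq
    (g := fun t : ℝ ↦ IccExtend (zero_le_one' ℝ) f t - a)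
    ((hf.Icc_extend' (h := zero_le_one' ℝ)).sub continuous_const)
    (fun t ↦ sub_ne_zero.mpr fun h ↦ ha ⟨_, h⟩)
  have hemb : IsClosedEmbedding f := hf.isClosedEmbedding hinj
  obtain ⟨g, hg⟩ := ContinuousMap.exists_extension' hemb
    (⟨fun t ↦ G t, by fun_prop⟩ : C(Icc (0 : ℝ) 1, ℂ))
  have hge : ∀ z ∈ range f, Complex.exp (g z) = z - a := by
    rintro _ ⟨t, rfl⟩
    have := congrFun hg t
    simp only [Function.comp_apply, ContinuousMap.coe_mk] at this
    rw [this, hGe, IccExtend_val]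
  set h : ℂ → ℂ := fun z ↦ if z ∈ closure V then Complex.exp (g z) else z - a with hh
  have hcont : Continuous h :=
    Continuous.if (fun z hz ↦ hge z (hfr (frontier_closure_subset hz)))
      (by fun_prop) (by fun_prop)
  have hne : ∀ z, h z ≠ 0 := fun z ↦ by
    simp only [hh]
    split_ifs with hz
    · exact Complex.exp_ne_zero _
    · exact sub_ne_zero.mpr fun e ↦ hz (e ▸ subset_closure haV)
  obtain ⟨l, hl, hle⟩ := Complex.exists_continuous_exp_eq hcont hne
  obtain ⟨R, hR, hVR⟩ := hV.closure.subset_ball_lt 0 a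
  refine Complex.not_forall_exp_eq_sub_on_sphere (a := a) hR hl fun z hz ↦ ?_
  rw [hle, hh]
  exact if_neg fun hz' ↦ (hVR hz').ne hz

/-- Two points are joined by an arc (possibly degenerate) inside `W`. -/
def ArcJoinedIn {X : Type*} [TopologicalSpace X] (W : Set X) (x y : X) : Prop :=
  ∃ (γ : ℝ → X) (a b : ℝ), a ≤ b ∧ ContinuousOn γ (Icc a b) ∧ InjOn γ (Icc a b) ∧
    γ a = x ∧ γ b = y ∧ MapsTo γ (Icc a b) W

namespace ArcJoinedIn

variable {X : Type*} [TopologicalSpace X] {W D : Set X} {x y z : X}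

lemma refl (hx : x ∈ W) : ArcJoinedIn W x x :=
  ⟨fun _ ↦ x, 0, 0, le_rfl, continuousOn_const, by simp, rfl, rfl, fun _ _ ↦ hx⟩

lemma mem_right (h : ArcJoinedIn W x y) : y ∈ W := by
  obtain ⟨γ, a, b, hab, -, -, -, rfl, hm⟩ := h
  exact hm (right_mem_Icc.mpr hab)

lemma mono {W' : Set X} (h : ArcJoinedIn W x y) (hW : W ⊆ W') : ArcJoinedIn W' x y := by
  obtain ⟨γ, a, b, hab, hc, hi, hx, hy, hm⟩ := h
  exact ⟨γ, a, b, hab, hc, hi, hx, hy, hm.mono_right hW⟩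

/-- Cut an arc at its first point in `D`. -/
lemma exists_first_mem (hD : IsClosed D) (h : ArcJoinedIn W x y) (hy : y ∈ D) :
    ∃ (γ : ℝ → X) (a b : ℝ), a ≤ b ∧ ContinuousOn γ (Icc a b) ∧ InjOn γ (Icc a b) ∧
      γ a = x ∧ γ b ∈ D ∧ MapsTo γ (Icc a b) W ∧ ∀ s ∈ Icc a b, γ s ∈ D → s = b := by
  obtain ⟨γ, a, b, hab, hc, hi, hx, rfl, hm⟩ := h
  obtain ⟨t, ⟨ht, htD⟩, hmin⟩ : ∃ t, IsLeast (Icc a b ∩ γ ⁻¹' D) t :=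
    (isCompact_Icc.of_isClosed_subset (hc.preimage_isClosed_of_isClosed isClosed_Icc hD)
      inter_subset_left).exists_isLeast ⟨b, right_mem_Icc.mpr hab, hy⟩
  have hsub : Icc a t ⊆ Icc a b := Icc_subset_Icc_right ht.2
  exact ⟨γ, a, t, ht.1, hc.mono hsub, hi.mono hsub, hx, htD, hm.mono_left hsub,
    fun s hs hsD ↦ le_antisymm hs.2 (hmin ⟨hsub hs, hsD⟩)⟩

/-- An arc ending in a closed set `D`, any two points of which are joined by an arc in `D`, can be
rerouted to end at any prescribed point of `D`. -/
lemma reroute (hD : IsClosed D) (hDW : D ⊆ W) (harc : ∀ u ∈ D, ∀ v ∈ D, ArcJoinedIn D u v)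
    (h : ArcJoinedIn W x y) (hy : y ∈ D) (hz : z ∈ D) : ArcJoinedIn W x z := by
  obtain ⟨γ, a, b, hab, hc, hi, hx, hb, hm, hlast⟩ := h.exists_first_mem hD hy
  obtain ⟨δ, c, d, hcd, hδc, hδi, hδ0, hδ1, hδm⟩ := harc _ hb _ hz
  set η : ℝ → X := fun s ↦ if s ≤ b then γ s else δ (s - b + c) with hη
  have hη₁ : EqOn η γ (Icc a b) := fun s hs ↦ if_pos hs.2
  have hη₂ : EqOn η (fun s ↦ δ (s - b + c)) (Icc b (b + (d - c))) := fun s hs ↦ by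
    rcases hs.1.eq_or_lt with rfl | hlt
    · simp [hη, hδ0]
    · exact if_neg hlt.not_ge
  have hshift : MapsTo (fun s ↦ s - b + c) (Icc b (b + (d - c))) (Icc c d) := fun s hs ↦ by
    constructor <;> linarith [hs.1, hs.2]
  have hunion : Icc a (b + (d - c)) = Icc a b ∪ Icc b (b + (d - c)) :=
    (Icc_union_Icc_eq_Icc hab (by linarith)).symm
  have hcross : ∀ s ∈ Icc a b, ∀ t ∈ Icc b (b + (d - c)), η s = η t → s = t := by
    intro s hs t ht hst
    rw [hη₁ hs, hη₂ ht] at hst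
    have hsb : s = b := hlast s hs (hst ▸ hδm (hshift ht))
    subst hsb
    have := hδi (hshift ht) (left_mem_Icc.mpr hcd) (hst.symm.trans hδ0.symm)
    linarith
  refine ⟨η, a, b + (d - c), by linarith, ?_, ?_, ?_, ?_, ?_⟩
  · rw [hunion]
    exact (hc.congr hη₁).union_of_isClosed
      ((hδc.comp (by fun_prop) hshift).congr hη₂) isClosed_Icc isClosed_Icc
  · rw [hunion]
    rintro s (hs | hs) t (ht | ht) hst
    · exact hi hs ht (by rwa [hη₁ hs, hη₁ ht] at hst)
    · exact hcross s hs t ht hst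
    · exact (hcross t ht s hs hst.symm).symm
    · rw [hη₂ hs, hη₂ ht] at hst
      have := hδi (hshift hs) (hshift ht) hst
      linarith
  · rw [hη₁ (left_mem_Icc.mpr hab), hx]
  · rw [hη₂ (right_mem_Icc.mpr (by linarith))]
    simp [hδ1]
  · rw [hunion]
    rintro s (hs | hs)
    · rw [hη₁ hs]; exact hm hs
    · rw [hη₂ hs]; exact hDW (hδm (hshift hs))

/-- In an open connected subset of a space with enough closed arc-connected neighbourhoods, any two
points are joined by an arc. -/
lemma of_isPreconnected
    (hX : ∀ (x : X), ∀ U ∈ 𝓝 x, ∃ D ∈ 𝓝 x, IsClosed D ∧ D ⊆ U ∧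
      ∀ u ∈ D, ∀ v ∈ D, ArcJoinedIn D u v)
    (hW : IsOpen W) (hconn : IsPreconnected W) (hx : x ∈ W) (hy : y ∈ W) : ArcJoinedIn W x y := by
  refine hconn.subset_of_closure_inter_subset (u := {y | ArcJoinedIn W x y}) ?_
    ⟨x, hx, refl hx⟩ ?_ hy
  · refine isOpen_iff_mem_nhds.mpr fun z hz ↦ ?_
    obtain ⟨D, hDz, hDc, hDW, harc⟩ := hX z W (hW.mem_nhds hz.mem_right)
    exact Filter.mem_of_superset hDz fun w hw ↦ hz.reroute hDc hDW harc (mem_of_mem_nhds hDz) hw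
  · rintro z ⟨hz, hzW⟩
    obtain ⟨D, hDz, hDc, hDW, harc⟩ := hX z W (hW.mem_nhds hzW)
    obtain ⟨w, hwD, hw⟩ := mem_closure_iff_nhds.mp hz D hDz
    exact hw.reroute hDc hDW harc hwD (mem_of_mem_nhds hDz)

/-- Any two points of a convex set are joined by a segment, and so is its image under an injective
continuous map. -/
lemma image_convex {E : Type*} [NormedAddCommGroup E] [NormedSpace ℝ E] {S : Set E}
    (hS : Convex ℝ S) {g : E → X} (hg : ContinuousOn g S) (hinj : InjOn g S) {u v : X}
    (hu : u ∈ g '' S) (hv : v ∈ g '' S) : ArcJoinedIn (g '' S) u v := by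
  obtain ⟨u, hu, rfl⟩ := hu
  obtain ⟨v, hv, rfl⟩ := hv
  rcases eq_or_ne u v with rfl | huv
  · exact refl (mem_image_of_mem g hu)
  have hmaps : MapsTo (AffineMap.lineMap u v : ℝ → E) (Icc 0 1) S := fun t ht ↦
    hS.segment_subset hu hv (segment_eq_image_lineMap ℝ u v ▸ mem_image_of_mem _ ht)
  exact ⟨fun t ↦ g (AffineMap.lineMap u v t), 0, 1, zero_le_one,
    hg.comp AffineMap.lineMap_continuous.continuousOn hmaps,
    hinj.comp (AffineMap.lineMap_injective ℝ huv).injOn hmaps, by simp, by simp,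
    fun t ht ↦ mem_image_of_mem g (hmaps ht)⟩

/-- A nondegenerate arc can be parametrized by the unit interval. -/
lemma exists_unitInterval (h : ArcJoinedIn W x y) (hxy : x ≠ y) :
    ∃ γ : Icc (0 : ℝ) 1 → X, Continuous γ ∧ Function.Injective γ ∧
      γ ⟨0, by norm_num⟩ = x ∧ γ ⟨1, by norm_num⟩ = y ∧ range γ ⊆ W := by
  obtain ⟨γ, a, b, hab, hc, hi, rfl, rfl, hm⟩ := h
  have hlt : a < b := hab.lt_of_ne fun e ↦ hxy (e ▸ rfl)
  let e := (iccHomeoI a b hlt).symm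
  refine ⟨fun t ↦ γ (e t), (continuousOn_iff_continuous_domRestrict.mp hc).comp e.continuous,
    fun s t hst ↦ e.injective (Subtype.ext (hi (e s).2 (e t).2 hst)), ?_, ?_, ?_⟩
  · simp [e]
  · simp [e]
  · rintro _ ⟨t, rfl⟩
    exact hm (e t).2

end ArcJoinedIn

/-- The frontier of a connected component of an open set lies outside this set. -/
lemma IsOpen.frontier_connectedComponentIn_subset {X : Type*} [TopologicalSpace X]
    [LocallyConnectedSpace X] {W : Set X} (hW : IsOpen W) (x : X) :
    frontier (connectedComponentIn W x) ⊆ Wᶜ := by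
  intro y hy hyW
  rw [hW.connectedComponentIn.frontier_eq] at hy
  obtain ⟨z, hzy, hzx⟩ := mem_closure_iff.mp hy.1 _ hW.connectedComponentIn
    (mem_connectedComponentIn hyW)
  apply hy.2
  rw [connectedComponentIn_eq hzx, ← connectedComponentIn_eq hzy]
  exact mem_connectedComponentIn hyW

section Sphere

variable (v : Metric.sphere (0 : EuclideanSpace ℝ (Fin 3)) 1)

/-- Stereographic projection of the 2-sphere to the complex plane. -/
noncomputable def stereographicComplex :
    OpenPartialHomeomorph (Metric.sphere (0 : EuclideanSpace ℝ (Fin 3)) 1) ℂ :=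
  haveI : Fact (Module.finrank ℝ (EuclideanSpace ℝ (Fin 3)) = 2 + 1) := ⟨by simp⟩
  (stereographic' 2 v).transHomeomorph Complex.orthonormalBasisOneI.repr.symm.toHomeomorph

@[simp] lemma stereographicComplex_source : (stereographicComplex v).source = {v}ᶜ := by
  simp [stereographicComplex]

@[simp] lemma stereographicComplex_target : (stereographicComplex v).target = univ := by
  simp [stereographicComplex]

lemma continuous_stereographicComplex_symm : Continuous (stereographicComplex v).symm := by
  simpa [continuousOn_univ] using (stereographicComplex v).continuousOn_symm

lemma injective_stereographicComplex_symm :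
    Function.Injective (stereographicComplex v).symm := by
  simpa [injOn_univ] using (stereographicComplex v).symm.injOn

lemma exists_arcConnected_nhds_sphere {U : Set (Metric.sphere (0 : EuclideanSpace ℝ (Fin 3)) 1)}
    (hU : U ∈ 𝓝 v) : ∃ D ∈ 𝓝 v, IsClosed D ∧ D ⊆ U ∧ ∀ x ∈ D, ∀ y ∈ D, ArcJoinedIn D x y := by
  set e := stereographicComplex (-v) with he
  have hv : v ∈ e.source := by
    simpa [he] using ne_neg_of_mem_unit_sphere ℝ v
  have hcont := continuous_stereographicComplex_symm (-v)
  obtain ⟨r, hr, hrU⟩ := Metric.nhds_basis_closedBall.mem_iff.mp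
    (hcont.continuousAt.preimage_mem_nhds (x := e v) (by rwa [← he, e.left_inv hv]))
  refine ⟨e.symm '' Metric.closedBall (e v) r, ?_,
    ((isCompact_closedBall _ _).image hcont).isClosed, image_subset_iff.mpr hrU,
    fun x hx y hy ↦ ArcJoinedIn.image_convex (convex_closedBall _ _) hcont.continuousOn
      (injective_stereographicComplex_symm (-v)).injOn hx hy⟩
  have := e.symm.image_mem_nhds (x := e v) (by simp [he])
    (Metric.closedBall_mem_nhds (e v) hr)
  rwa [e.left_inv hv] at this

/-- The complement of an arc in the 2-sphere has a single connected component. -/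
lemma mem_connectedComponentIn_compl_range_arc
    {f : Icc (0 : ℝ) 1 → Metric.sphere (0 : EuclideanSpace ℝ (Fin 3)) 1} (hf : Continuous f)
    (hinj : Function.Injective f) {p q : Metric.sphere (0 : EuclideanSpace ℝ (Fin 3)) 1}
    (hp : p ∉ range f) (hq : q ∉ range f) : p ∈ connectedComponentIn (range f)ᶜ q := by
  have : Fact (Module.finrank ℝ (EuclideanSpace ℝ (Fin 3)) = 2 + 1) := ⟨by simp⟩
  have : LocallyConnectedSpace (Metric.sphere (0 : EuclideanSpace ℝ (Fin 3)) 1) :=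
    ChartedSpace.locallyConnectedSpace (EuclideanSpace ℝ (Fin 2)) _
  have hW : IsOpen (range f)ᶜ := (isCompact_range hf).isClosed.isOpen_compl
  by_contra hpU
  set U := connectedComponentIn (range f)ᶜ q with hU
  have hUo : IsOpen U := hW.connectedComponentIn
  have hqU : q ∈ U := mem_connectedComponentIn hq
  have hfr : frontier U ⊆ range f := by
    simpa using hW.frontier_connectedComponentIn_subset q
  set e := stereographicComplex p with he
  have hsub : ∀ {s : Set (Metric.sphere (0 : EuclideanSpace ℝ (Fin 3)) 1)}, p ∉ s →
      s ⊆ e.source := fun hs x hx ↦ by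
    simpa [he] using fun h : x = p ↦ hs (h ▸ hx)
  have hpcl : p ∉ closure U := fun h ↦ hp (hfr (hUo.frontier_eq ▸ ⟨h, hpU⟩))
  have hK : IsCompact (e '' closure U) :=
    isClosed_closure.isCompact.image_of_continuousOn (e.continuousOn.mono (hsub hpcl))
  have hVo : IsOpen (e '' U) := e.isOpen_image_of_subset_source hUo (hsub hpU)
  have hV : closure (e '' U) ⊆ e '' closure U :=
    closure_minimal (image_mono subset_closure) hK.isClosed
  have hqf : e q ∉ range (e ∘ f) := by
    rintro ⟨t, ht⟩
    exact hq ⟨t, e.injOn (hsub hp ⟨t, rfl⟩) (hsub hpU hqU) ht⟩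
  refine Complex.not_frontier_subset_range_arc (f := e ∘ f)
    (e.continuousOn.comp_continuous hf fun t ↦ hsub hp ⟨t, rfl⟩)
    (fun s t hst ↦ hinj (e.injOn (hsub hp ⟨s, rfl⟩) (hsub hp ⟨t, rfl⟩) hst))
    (hK.isBounded.subset (image_mono subset_closure)) (mem_image_of_mem e hqU) hqf ?_
  intro z hz
  rw [hVo.frontier_eq] at hz
  obtain ⟨x, hx, rfl⟩ := hV hz.1
  obtain ⟨t, rfl⟩ : x ∈ range f :=
    hfr (hUo.frontier_eq ▸ ⟨hx, fun h ↦ hz.2 (mem_image_of_mem e h)⟩)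
  exact ⟨t, rfl⟩

end Sphere


/-- Given an embedded arc `A` in the 2-sphere and two distinct points `p, q` off `A`,
there is an embedded arc from `p` to `q` disjoint from `A`. -/
theorem exists_embedded_arc_in_arc_complement
    (f : Set.Icc (0:ℝ) 1 → Metric.sphere (0 : EuclideanSpace ℝ (Fin 3)) 1)
    (hf_cont : Continuous f) (hf_inj : Function.Injective f)
    (A : Set (Metric.sphere (0 : EuclideanSpace ℝ (Fin 3)) 1))
    (hA : A = Set.range f)
    (p q : Metric.sphere (0 : EuclideanSpace ℝ (Fin 3)) 1)
    (hpq : p ≠ q) (hp : p ∉ A) (hq : q ∉ A) :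
    ∃ γ : Set.Icc (0:ℝ) 1 → Metric.sphere (0 : EuclideanSpace ℝ (Fin 3)) 1,
      Continuous γ ∧ Function.Injective γ ∧
      γ ⟨0, by norm_num⟩ = p ∧ γ ⟨1, by norm_num⟩ = q ∧
      Disjoint (Set.range γ) A := by
  subst hA
  have : Fact (Module.finrank ℝ (EuclideanSpace ℝ (Fin 3)) = 2 + 1) := ⟨by simp⟩
  have : LocallyConnectedSpace (Metric.sphere (0 : EuclideanSpace ℝ (Fin 3)) 1) :=
    ChartedSpace.locallyConnectedSpace (EuclideanSpace ℝ (Fin 2)) _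
  have hW : IsOpen (range f)ᶜ := (isCompact_range hf_cont).isClosed.isOpen_compl
  have hjoin := ArcJoinedIn.of_isPreconnected
    (fun x U hU ↦ exists_arcConnected_nhds_sphere x hU)
    (hW.connectedComponentIn (x := q)) isPreconnected_connectedComponentIn
    (mem_connectedComponentIn_compl_range_arc hf_cont hf_inj hp hq) (mem_connectedComponentIn hq)
  obtain ⟨γ, hc, hi, h0, h1, hr⟩ :=
    (hjoin.mono (connectedComponentIn_subset _ _)).exists_unitInterval hpq
  exact ⟨γ, hc, hi, h0, h1, disjoint_left.mpr hr⟩
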